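/- arXiv:1807.01845 — 3 statements merged into one kernel-verified Lean document; each statement's English description precedes it below -/
import Mathlib

section
/- Let A_e be an n×n real matrix, G_e an n×m real matrix, C_e a p×n real matrix, R a p×p real positive definite matrix, M an m×m real positive definite matrix, and D an m×m real positive semidefinite matrix. For λ ∈ (0,1) set Q_e(λ) = (((1−λ)/λ)·M + D)⁻¹. Let Φ₀ be a fixed positive definite n×n matrix (independent of λ) and define recursively, for k ≥ 0 and λ ∈ (0,1), Φ_{k+1}(λ) = G_e Q_e(λ) G_eᵀ + A_e Φ_k(λ) A_eᵀ − A_e Φ_k(λ) C_eᵀ (R + C_e Φ_k(λ) C_eᵀ)⁻¹ C_e Φ_k(λ) A_eᵀ, with Φ₀(λ) = Φ₀. Assume Φ_k(λ) is positive definite for every k ≥ 0 and λ ∈ (0,1). Then for every k ≥ 0 and every λ ∈ (0,1), the map λ ↦ Φ_k(λ) is differentiable at λ and its derivative is positive semidefinite. -/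
open Matrix

def HD {a b : ℕ} (F : ℝ → Matrix (Fin a) (Fin b) ℝ) (F' : Matrix (Fin a) (Fin b) ℝ) (x : ℝ) : Prop :=
  ∀ i j, HasDerivAt (fun l : ℝ => F l i j) (F' i j) x

theorem HD.const {a b : ℕ} (F : Matrix (Fin a) (Fin b) ℝ) (x : ℝ) : HD (fun _ => F) 0 x :=
  fun i j => hasDerivAt_const x (F i j)

theorem HD.add {a b : ℕ} {F G : ℝ → Matrix (Fin a) (Fin b) ℝ} {F' G' x}
    (hF : HD F F' x) (hG : HD G G' x) : HD (fun l => F l + G l) (F' + G') x :=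
  fun i j => (hF i j).add (hG i j)

theorem HD.sub {a b : ℕ} {F G : ℝ → Matrix (Fin a) (Fin b) ℝ} {F' G' x}
    (hF : HD F F' x) (hG : HD G G' x) : HD (fun l => F l - G l) (F' - G') x :=
  fun i j => (hF i j).sub (hG i j)

theorem HD.mul {a b c : ℕ} {F : ℝ → Matrix (Fin a) (Fin b) ℝ} {G : ℝ → Matrix (Fin b) (Fin c) ℝ}
    {F' G' x} (hF : HD F F' x) (hG : HD G G' x) :
    HD (fun l => F l * G l) (F' * G x + F x * G') x := by
  intro i j
  simp only [Matrix.mul_apply, Matrix.add_apply, ← Finset.sum_add_distrib]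
  exact HasDerivAt.fun_sum fun k _ => (hF i k).mul (hG k j)

theorem HD.inv {a : ℕ} {F : ℝ → Matrix (Fin a) (Fin a) ℝ} {F' x}
    (hF : HD F F' x) (hu : IsUnit (F x)) :
    HD (fun l => (F l)⁻¹) (-((F x)⁻¹ * F' * (F x)⁻¹)) x := by
  have hdiff : ∃ I', HD (fun l => (F l)⁻¹) I' x := by
    have hdet : ∀ (G : ℝ → Matrix (Fin a) (Fin a) ℝ),
        (∀ i j, DifferentiableAt ℝ (fun l => G l i j) x) → 
        DifferentiableAt ℝ (fun l => (G l).det) x := by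
      intro G hG
      simp only [Matrix.det_apply]
      fun_prop
    have hd0 : (F x).det ≠ 0 := ((Matrix.isUnit_iff_isUnit_det _).1 hu).ne_zero
    have : ∀ i j, DifferentiableAt ℝ (fun l => (F l)⁻¹ i j) x := by
      intro i j
      simp only [Matrix.inv_def, Matrix.smul_apply, Ring.inverse_eq_inv', smul_eq_mul,
        Matrix.adjugate_apply]
      refine DifferentiableAt.mul ((hdet F fun i j => (hF i j).differentiableAt).inv hd0) ?_
      apply hdet
      intro i' j'
      simp only [Matrix.updateRow_apply]
      split_ifs
      · fun_prop
      · exact (hF _ _).differentiableAt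
    exact ⟨fun i j => deriv (fun l => (F l)⁻¹ i j) x, fun i j => (this i j).hasDerivAt⟩
  obtain ⟨I', hI⟩ := hdiff
  have hev : ∀ᶠ l in nhds x, F l * (F l)⁻¹ = 1 := by
    have hd0 : (F x).det ≠ 0 := ((Matrix.isUnit_iff_isUnit_det _).1 hu).ne_zero
    have hc : ContinuousAt (fun l => (F l).det) x := by
      have : ContinuousAt F x := by
        refine continuousAt_pi.2 fun i => continuousAt_pi.2 fun j => (hF i j).continuousAt
      exact (Continuous.matrix_det continuous_id).continuousAt.comp this
    filter_upwards [hc.eventually_ne hd0] with l hl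
    exact Matrix.mul_nonsing_inv _ (isUnit_iff_ne_zero.2 hl)
  have h1 := hF.mul hI
  have h2 : F' * (F x)⁻¹ + F x * I' = 0 := by
    ext i j
    refine (h1 i j).unique ?_
    refine (hasDerivAt_const x ((1 : Matrix (Fin a) (Fin a) ℝ) i j)).congr_of_eventuallyEq ?_
    filter_upwards [hev] with l hl
    rw [hl]
  have h3 : I' = -((F x)⁻¹ * F' * (F x)⁻¹) := by
    have h4 : (F x)⁻¹ * (F' * (F x)⁻¹ + F x * I') = 0 := by rw [h2, Matrix.mul_zero]
    rw [Matrix.mul_add, ← Matrix.mul_assoc, ← Matrix.mul_assoc (F x)⁻¹ (F x),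
      Matrix.nonsing_inv_mul _ ((Matrix.isUnit_iff_isUnit_det _).1 hu), Matrix.one_mul] at h4
    exact eq_neg_of_add_eq_zero_right h4
  exact h3 ▸ hI

/-- For the λ-parameterized Riccati recursion
Φ_{k+1}(λ) = G_e Q_e(λ) G_eᵀ + A_e Φ_k(λ) A_eᵀ − A_e Φ_k(λ) C_eᵀ (R + C_e Φ_k(λ) C_eᵀ)⁻¹ C_e Φ_k(λ) A_eᵀ
with Q_e(λ) = (((1−λ)/λ)M + D)⁻¹, Φ₀ positive definite and independent of λ, and all iterates
positive definite on (0,1), every iterate is (entrywise) differentiable in λ on (0,1) with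
positive semidefinite derivative. -/
theorem stmt7 {n m p : ℕ}
    (Ae : Matrix (Fin n) (Fin n) ℝ) (Ge : Matrix (Fin n) (Fin m) ℝ)
    (Ce : Matrix (Fin p) (Fin n) ℝ) (R : Matrix (Fin p) (Fin p) ℝ) (hR : R.PosDef)
    (M D : Matrix (Fin m) (Fin m) ℝ) (hM : M.PosDef) (hD : D.PosSemidef)
    (Φ : ℕ → ℝ → Matrix (Fin n) (Fin n) ℝ) (Φ0 : Matrix (Fin n) (Fin n) ℝ)
    (hΦ0 : Φ0.PosDef)
    (h0 : ∀ lam ∈ Set.Ioo (0:ℝ) 1, Φ 0 lam = Φ0)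
    (hrec : ∀ k : ℕ, ∀ lam ∈ Set.Ioo (0:ℝ) 1,
      Φ (k + 1) lam
        = Ge * (((1 - lam) / lam) • M + D)⁻¹ * Geᵀ + Ae * Φ k lam * Aeᵀ
          - Ae * Φ k lam * Ceᵀ * (R + Ce * Φ k lam * Ceᵀ)⁻¹ * (Ce * Φ k lam * Aeᵀ))
    (hpd : ∀ k : ℕ, ∀ lam ∈ Set.Ioo (0:ℝ) 1, (Φ k lam).PosDef) :
    ∀ k : ℕ, ∀ lam ∈ Set.Ioo (0:ℝ) 1, ∃ Φ' : Matrix (Fin n) (Fin n) ℝ,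
      (∀ i j, HasDerivAt (fun l : ℝ => Φ k l i j) (Φ' i j) lam) ∧ Φ'.PosSemidef := by
  intro k
  induction k with
  | zero =>
    intro x hx
    refine ⟨0, fun i j => ?_, Matrix.PosSemidef.zero⟩
    refine (hasDerivAt_const x (Φ0 i j)).congr_of_eventuallyEq ?_
    filter_upwards [isOpen_Ioo.mem_nhds hx] with l hl
    rw [h0 l hl]
  | succ k ih =>
    intro x hx
    obtain ⟨P', hP, hP'⟩ := ih x hx
    have hP : HD (Φ k) P' x := hP
    have hPT : (Φ k x)ᵀ = Φ k x := by simpa using (hpd k x hx).isHermitian.eq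
    have hx0 : x ≠ 0 := hx.1.ne'
    -- Q
    have hQ0 : (((1 - x) / x) • M + D).PosDef :=
      (hM.smul (div_pos (sub_pos.2 hx.2) hx.1)).add_posSemidef hD
    have hd : HasDerivAt (fun l : ℝ => (1 - l) / l) (-(x ^ 2)⁻¹) x := by
      have := ((hasDerivAt_id x).const_sub 1).div (hasDerivAt_id x) hx0
      refine this.congr_deriv ?_
      simp only [id]
      field_simp
      ring
    have hW : HD (fun l : ℝ => ((1 - l) / l) • M + D) ((-(x ^ 2)⁻¹) • M + 0) x :=
      HD.add (fun i j => hd.mul_const (M i j)) (HD.const D x)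
    have hQ := hW.inv hQ0.isUnit
    set Q := (((1 - x) / x) • M + D)⁻¹ with hQdef
    have hQT : Qᵀ = Q := by simpa using hQ0.inv.isHermitian.eq
    -- S
    have hS0 : (R + Ce * Φ k x * Ceᵀ).PosDef := by
      refine hR.add_posSemidef ?_
      simpa using (hpd k x hx).posSemidef.mul_mul_conjTranspose_same Ce
    have hS := ((HD.const R x).add (((HD.const Ce x).mul hP).mul (HD.const Ceᵀ x))).inv hS0.isUnit
    set T := (R + Ce * Φ k x * Ceᵀ)⁻¹ with hTdef
    have hTT : Tᵀ = T := by simpa using hS0.inv.isHermitian.eq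
    have hAP := (HD.const Ae x).mul hP
    have hmain := ((((HD.const Ge x).mul hQ).mul (HD.const Geᵀ x)).add
      (hAP.mul (HD.const Aeᵀ x))).sub
      (((hAP.mul (HD.const Ceᵀ x)).mul hS).mul
        (((HD.const Ce x).mul hP).mul (HD.const Aeᵀ x)))
    refine ⟨(x ^ 2)⁻¹ • ((Ge * Q) * M * (Ge * Q)ᵀ) +
      (Ae - Ae * Φ k x * Ceᵀ * T * Ce) * P' * (Ae - Ae * Φ k x * Ceᵀ * T * Ce)ᵀ, ?_, ?_⟩
    · have heq : HD (Φ (k+1)) _ x := fun i j => (hmain i j).congr_of_eventuallyEq (by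
        filter_upwards [isOpen_Ioo.mem_nhds hx] with l hl
        rw [hrec k l hl])
      rw [← hTdef, ← hQdef] at heq
      change HD _ _ x
      convert heq using 1
      simp only [Matrix.transpose_sub, Matrix.transpose_mul, Matrix.transpose_transpose, hTT, hQT,
        hPT, Matrix.zero_mul, Matrix.mul_zero, zero_add, add_zero, Matrix.mul_sub, Matrix.sub_mul,
        Matrix.mul_add, Matrix.add_mul, Matrix.mul_neg, Matrix.neg_mul, Matrix.mul_assoc,
        Matrix.smul_mul, Matrix.mul_smul, neg_smul, neg_neg]
      abel
    · refine Matrix.PosSemidef.add (Matrix.PosSemidef.smul ?_ (by positivity)) ?_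
      · simpa using hM.posSemidef.mul_mul_conjTranspose_same (Ge * Q)
      · simpa using hP'.mul_mul_conjTranspose_same (Ae - Ae * Φ k x * Ceᵀ * T * Ce)
end

section
/- Let μ, μ̄ be positive reals, and for λ ∈ (0,1) set λ̄ = λμ + (1−λ)μ̄ and λ̃(λ) = λ/λ̄. Let K be an n×n real symmetric positive definite matrix (n ≥ 1), let a_l > 0, and define a(λ) = a_l‖(I + λ̃(λ)K)⁻¹‖_F. Then: (i) a is strictly decreasing on (0,1); (ii) if in addition a(λ) < 1 for all λ ∈ (0,1), then the map λ ↦ 1/(1 − a(λ)) is strictly decreasing on (0,1). -/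
open Matrix

/-- The Frobenius norm of a real matrix: ‖M‖_F = √(trace(MᵀM)). -/
noncomputable def frobNorm {n m : ℕ} (M : Matrix (Fin n) (Fin m) ℝ) : ℝ :=
  Real.sqrt (Mᵀ * M).trace

theorem frob_formula_aux {n : ℕ} (K : Matrix (Fin n) (Fin n) ℝ) (hK : K.PosDef) :
    ∃ d : Fin n → ℝ, (∀ i, 0 < d i) ∧ ∀ s : ℝ, 0 < s →
      frobNorm ((1 + s • K)⁻¹) = Real.sqrt (∑ i, ((1 + s * d i)⁻¹) ^ 2) := by
  refine ⟨hK.1.eigenvalues, hK.eigenvalues_pos, ?_⟩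
  have hpos := hK.eigenvalues_pos
  have hsp := hK.1.spectral_theorem
  rw [Unitary.conjStarAlgAut_apply] at hsp
  have h1 : (hK.1.eigenvectorUnitary : Matrix (Fin n) (Fin n) ℝ) * star (hK.1.eigenvectorUnitary : Matrix (Fin n) (Fin n) ℝ) = 1 :=
    Unitary.coe_mul_star_self hK.1.eigenvectorUnitary
  have h2 := Unitary.coe_star_mul_self hK.1.eigenvectorUnitary
  have hst : star (hK.1.eigenvectorUnitary : Matrix (Fin n) (Fin n) ℝ)
      = (hK.1.eigenvectorUnitary : Matrix (Fin n) (Fin n) ℝ)ᵀ := by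
    rw [star_eq_conjTranspose, conjTranspose_eq_transpose_of_trivial]
  rw [hst] at h1 h2 hsp
  generalize (hK.1.eigenvectorUnitary : Matrix (Fin n) (Fin n) ℝ) = U at *
  generalize hK.1.eigenvalues = d at *
  intro s hs
  have hd : ∀ i, 1 + s * d i ≠ 0 := fun i => by
    have := mul_pos hs (hpos i); positivity
  have hsp2 : K = U * diagonal d * Uᵀ := hsp
  have hA : 1 + s • K = U * diagonal (fun i => 1 + s * d i) * Uᵀ := by
    have : diagonal (fun i => 1 + s * d i) = 1 + s • diagonal d := by
      ext i j
      by_cases h : i = j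
      · subst h; simp
      · simp [h]
    rw [this, mul_add, add_mul, mul_one, h1, hsp2]
    simp
  have hB : (1 + s • K)⁻¹ = U * diagonal (fun i => (1 + s * d i)⁻¹) * Uᵀ := by
    apply Matrix.inv_eq_right_inv
    rw [hA]
    calc _ = U * diagonal (fun i => 1 + s * d i) * (Uᵀ * U)
          * diagonal (fun i => (1 + s * d i)⁻¹) * Uᵀ := by simp only [Matrix.mul_assoc]
      _ = U * (diagonal (fun i => 1 + s * d i)
          * diagonal (fun i => (1 + s * d i)⁻¹)) * Uᵀ := by
            rw [h2]; simp only [Matrix.mul_assoc, Matrix.mul_one]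
      _ = 1 := by
            rw [diagonal_mul_diagonal]
            simp [hd, h1]
  rw [hB, frobNorm]
  congr 1
  rw [transpose_mul, transpose_mul, transpose_transpose, diagonal_transpose]
  calc _ = (U * (diagonal (fun i => (1 + s * d i)⁻¹) * (Uᵀ * U)
          * diagonal (fun i => (1 + s * d i)⁻¹) * Uᵀ)).trace := by simp only [Matrix.mul_assoc]
    _ = _ := by
      rw [h2, Matrix.trace_mul_comm, Matrix.mul_assoc, h2, Matrix.mul_one, Matrix.mul_one,
        diagonal_mul_diagonal, trace_diagonal]
      simp [pow_two]

/-- With λ̄ = λμ + (1−λ)μ̄, λ̃(λ) = λ/λ̄ (μ, μ̄ > 0), K symmetric positive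
definite (n ≥ 1), a_l > 0 and a(λ) = a_l‖(I + λ̃(λ)K)⁻¹‖_F: (i) a is strictly decreasing
on (0,1); (ii) if moreover a(λ) < 1 for all λ ∈ (0,1), then λ ↦ 1/(1 − a(λ)) is strictly
decreasing on (0,1). -/
theorem stmt15 (mu mub : ℝ) (hmu : 0 < mu) (hmub : 0 < mub) {n : ℕ} (hn : 1 ≤ n)
    (K : Matrix (Fin n) (Fin n) ℝ) (hK : K.PosDef) (al : ℝ) (hal : 0 < al) :
    StrictAntiOn
      (fun lam : ℝ => al * frobNorm
        (((1 : Matrix (Fin n) (Fin n) ℝ) + (lam / (lam * mu + (1 - lam) * mub)) • K)⁻¹))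
      (Set.Ioo (0:ℝ) 1) ∧
    ((∀ lam ∈ Set.Ioo (0:ℝ) 1, al * frobNorm
        (((1 : Matrix (Fin n) (Fin n) ℝ) + (lam / (lam * mu + (1 - lam) * mub)) • K)⁻¹) < 1) →
      StrictAntiOn
        (fun lam : ℝ => 1 / (1 - al * frobNorm
          (((1 : Matrix (Fin n) (Fin n) ℝ) + (lam / (lam * mu + (1 - lam) * mub)) • K)⁻¹)))
        (Set.Ioo (0:ℝ) 1)) := by
  obtain ⟨d, hd, hf⟩ := frob_formula_aux K hK
  have hden : ∀ x ∈ Set.Ioo (0:ℝ) 1, 0 < x * mu + (1 - x) * mub := fun x hx => by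
    have := mul_pos hx.1 hmu
    have := mul_pos (sub_pos.2 hx.2) hmub
    linarith
  have main : StrictAntiOn
      (fun lam : ℝ => al * frobNorm
        (((1 : Matrix (Fin n) (Fin n) ℝ) + (lam / (lam * mu + (1 - lam) * mub)) • K)⁻¹))
      (Set.Ioo (0:ℝ) 1) := by
    intro x hx y hy hxy
    have hdx := hden x hx
    have hdy := hden y hy
    have hsx := div_pos hx.1 hdx
    have hsy := div_pos hy.1 hdy
    have hlt : x / (x * mu + (1 - x) * mub) < y / (y * mu + (1 - y) * mub) := by
      rw [div_lt_div_iff₀ hdx hdy]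
      nlinarith [mul_pos (sub_pos.2 hxy) hmub]
    dsimp only
    rw [hf _ hsx, hf _ hsy]
    refine mul_lt_mul_of_pos_left ?_ hal
    refine Real.sqrt_lt_sqrt (Finset.sum_nonneg fun i _ => sq_nonneg _) ?_
    refine Finset.sum_lt_sum_of_nonempty ⟨⟨0, hn⟩, Finset.mem_univ _⟩ fun i _ => ?_
    have p1 := mul_pos hsx (hd i)
    have p2 := mul_pos hsy (hd i)
    have p3 := mul_lt_mul_of_pos_right hlt (hd i)
    refine pow_lt_pow_left₀ ?_ (by positivity) two_ne_zero
    exact inv_strictAnti₀ (by positivity) (by linarith)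
  refine ⟨main, fun h x hx y hy hxy => ?_⟩
  have h1 := main hx hy hxy
  have h2 := h x hx
  dsimp only at h1 ⊢
  exact one_div_lt_one_div_of_lt (by linarith) (by linarith)
end

section
/- Let λ₀ ∈ (0,1). Let A_e be an n×n real matrix, G_e an invertible n×n real matrix, C_e a p×n real matrix, R a p×p real positive definite matrix, M an n×n real positive definite matrix, and D an n×n real positive semidefinite matrix; for λ ∈ (0,1) set Q_e(λ) = (((1−λ)/λ)·M + D)⁻¹. Suppose Φ : (0,1) → (n×n real symmetric positive semidefinite matrices) is differentiable at λ₀ with derivative Φ'(λ₀), and that for every λ ∈ (0,1) it satisfies the discrete algebraic Riccati equation Φ(λ) = G_e Q_e(λ) G_eᵀ + A_e Φ(λ) A_eᵀ − A_e Φ(λ) C_eᵀ (R + C_e Φ(λ) C_eᵀ)⁻¹ C_e Φ(λ) A_eᵀ. Define L̄ = A_e Φ(λ₀) C_eᵀ (R + C_e Φ(λ₀) C_eᵀ)⁻¹ and assume Ā_L = A_e − L̄ C_e is Schur stable. Then Φ'(λ₀) is positive definite. -/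
open Matrix

/-- A real square matrix is Schur stable if every eigenvalue of it, regarded as a matrix
over ℂ, has modulus strictly less than 1. -/
def SchurStable {n : ℕ} (A : Matrix (Fin n) (Fin n) ℝ) : Prop :=
  ∀ μ ∈ spectrum ℂ (A.map (Complex.ofReal)), ‖μ‖ < 1

attribute [local instance] Matrix.linftyOpNormedRing Matrix.linftyOpNormedAlgebra in
lemma aux_inv {n : ℕ} (X : ℝ → Matrix (Fin n) (Fin n) ℝ) (X' : Matrix (Fin n) (Fin n) ℝ) (t : ℝ)
    (h : ∀ i j, HasDerivAt (fun l => X l i j) (X' i j) t) (hu : IsUnit (X t)) :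
    ∀ i j, HasDerivAt (fun l => (X l)⁻¹ i j) ((-((X t)⁻¹ * X' * (X t)⁻¹)) i j) t := by
  have h1 : HasDerivAt X X' t := by
    refine hasDerivAt_iff_tendsto_slope.2 ?_
    have : ∀ i j, Filter.Tendsto (fun l => slope X t l i j) (nhdsWithin t {t}ᶜ) (nhds (X' i j)) := by
      intro i j
      have := h i j
      rw [hasDerivAt_iff_tendsto_slope] at this
      exact this
    exact tendsto_pi_nhds.2 fun i => tendsto_pi_nhds.2 fun j => this i j
  obtain ⟨u, hu⟩ := hu
  have h2 := (hasFDerivAt_ringInverse (𝕜 := ℝ) u)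
  rw [hu] at h2
  have h3 := h2.comp_hasDerivAt t h1
  replace h3 := hasDerivAt_iff_tendsto_slope.1 h3
  intro i j
  rw [hasDerivAt_iff_tendsto_slope]
  have h4 := tendsto_pi_nhds.1 (tendsto_pi_nhds.1 h3 i) j
  have e : ((u⁻¹ : (Matrix (Fin n) (Fin n) ℝ)ˣ) : Matrix (Fin n) (Fin n) ℝ) = (X t)⁻¹ := by
    rw [← hu]; simp
  simp only [Matrix.nonsing_inv_eq_ringInverse]
  rw [← Matrix.nonsing_inv_eq_ringInverse, ← e]
  exact h4

lemma aux_mul {n m k : ℕ} (X : ℝ → Matrix (Fin n) (Fin m) ℝ) (X' : Matrix (Fin n) (Fin m) ℝ)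
    (Y : ℝ → Matrix (Fin m) (Fin k) ℝ) (Y' : Matrix (Fin m) (Fin k) ℝ) (t : ℝ)
    (h : ∀ i j, HasDerivAt (fun l => X l i j) (X' i j) t)
    (h' : ∀ i j, HasDerivAt (fun l => Y l i j) (Y' i j) t) :
    ∀ i j, HasDerivAt (fun l => (X l * Y l) i j) ((X' * Y t + X t * Y') i j) t := by
  intro i j
  simp only [Matrix.mul_apply, Matrix.add_apply, ← Finset.sum_add_distrib]
  exact HasDerivAt.fun_sum fun q _ => (h i q).mul (h' q j)

lemma aux_const {n m : ℕ} (X : Matrix (Fin n) (Fin m) ℝ) (t : ℝ) :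
    ∀ i j, HasDerivAt (fun _ : ℝ => X i j) ((0 : Matrix (Fin n) (Fin m) ℝ) i j) t :=
  fun _ _ => hasDerivAt_const _ _

attribute [local instance] Matrix.linftyOpNormedRing Matrix.linftyOpNormedAlgebra in
lemma aux_pow {n : ℕ} (A : Matrix (Fin n) (Fin n) ℝ) (h : SchurStable A) :
    Filter.Tendsto (fun k : ℕ => A ^ k) Filter.atTop (nhds 0) := by
  rcases isEmpty_or_nonempty (Fin n) with hn | hn
  · have : (fun k : ℕ => A ^ k) = fun _ => 0 := by
      funext k; ext i; exact hn.elim i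
    rw [this]; exact tendsto_const_nhds
  set B : Matrix (Fin n) (Fin n) ℂ := A.map Complex.ofReal with hB
  have h1 : spectralRadius ℂ B < (1 : NNReal) :=
    spectrum.spectralRadius_lt_of_forall_lt B (fun μ hμ => by
      have := h μ hμ
      exact_mod_cast this)
  have h2 := spectrum.pow_nnnorm_pow_one_div_tendsto_nhds_spectralRadius B
  obtain ⟨r, hr1, hr2⟩ := ENNReal.lt_iff_exists_nnreal_btwn.1 h1
  have h3 := h2.eventually_lt_const hr1
  have hr3 : r < 1 := by exact_mod_cast hr2
  have h4 : ∀ᶠ k : ℕ in Filter.atTop, ‖B ^ k‖ ≤ (r : ℝ) ^ k := by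
    filter_upwards [h3, Filter.eventually_gt_atTop 0] with k hk hk0
    have hk' : (0:ℝ) < k := by exact_mod_cast hk0
    rw [one_div, ENNReal.rpow_inv_lt_iff hk'] at hk
    rw [ENNReal.rpow_natCast] at hk
    have : ‖B ^ k‖₊ < r ^ k := by exact_mod_cast hk
    exact_mod_cast this.le
  have h5 : Filter.Tendsto (fun k : ℕ => B ^ k) Filter.atTop (nhds 0) :=
    squeeze_zero_norm' h4 (tendsto_pow_atTop_nhds_zero_of_lt_one r.2 (by exact_mod_cast hr3))
  refine tendsto_pi_nhds.2 fun i => tendsto_pi_nhds.2 fun j => ?_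
  have h6 := (Complex.continuous_re.tendsto _).comp (tendsto_pi_nhds.1 (tendsto_pi_nhds.1 h5 i) j)
  have h7 : ∀ k, (B ^ k) i j = ((A ^ k) i j : ℝ) := by
    intro k
    have : B ^ k = (A ^ k).map Complex.ofReal := by
      have := map_pow (Complex.ofRealHom.mapMatrix (m := Fin n)) A k
      exact this.symm
    rw [this]; rfl
  simpa [Function.comp_def, h7] using h6

lemma aux_lyap {n : ℕ} (A H W : Matrix (Fin n) (Fin n) ℝ) (h : SchurStable A) (hW : W.PosDef)
    (hH : Hᵀ = H) (e : H = W + A * H * Aᵀ) : H.PosDef := by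
  refine Matrix.PosDef.of_dotProduct_mulVec_pos (by simpa [Matrix.IsHermitian] using hH) ?_
  have hq : ∀ x : Fin n → ℝ, x ⬝ᵥ (H *ᵥ x) = x ⬝ᵥ (W *ᵥ x) + (Aᵀ *ᵥ x) ⬝ᵥ (H *ᵥ (Aᵀ *ᵥ x)) := by
    intro x
    conv_lhs => rw [e]
    rw [Matrix.add_mulVec, dotProduct_add, ← Matrix.mulVec_mulVec, ← Matrix.mulVec_mulVec,
      Matrix.dotProduct_mulVec x A, ← Matrix.mulVec_transpose]
  have hw : ∀ x : Fin n → ℝ, 0 ≤ x ⬝ᵥ (W *ᵥ x) := fun x => by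
    simpa using hW.posSemidef.dotProduct_mulVec_nonneg x
  have hk : ∀ (k : ℕ) (x : Fin n → ℝ),
      (((A ^ k)ᵀ) *ᵥ x) ⬝ᵥ (H *ᵥ (((A ^ k)ᵀ) *ᵥ x)) ≤ x ⬝ᵥ (H *ᵥ x) := by
    intro k x
    induction k with
    | zero => simp
    | succ k ih =>
      have := hq ((A ^ k)ᵀ *ᵥ x)
      have h2 := hw ((A ^ k)ᵀ *ᵥ x)
      have h3 : (A ^ (k+1))ᵀ *ᵥ x = Aᵀ *ᵥ ((A ^ k)ᵀ *ᵥ x) := by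
        rw [Matrix.mulVec_mulVec, ← Matrix.transpose_mul, pow_succ]
      rw [h3]; linarith
  have hpos : ∀ x : Fin n → ℝ, 0 ≤ x ⬝ᵥ (H *ᵥ x) := by
    intro x
    have hc : Continuous (fun B : Matrix (Fin n) (Fin n) ℝ => (Bᵀ *ᵥ x) ⬝ᵥ (H *ᵥ (Bᵀ *ᵥ x))) := by
      fun_prop
    have := (hc.tendsto 0).comp (aux_pow A h)
    simp only [Matrix.transpose_zero, Matrix.zero_mulVec, zero_dotProduct] at this
    exact le_of_tendsto' this fun k => hk k x
  intro x hx
  have h1 : 0 < x ⬝ᵥ (W *ᵥ x) := by simpa using hW.dotProduct_mulVec_pos hx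
  have := hq x
  have := hpos (Aᵀ *ᵥ x)
  simp only [star_trivial]
  linarith

/-- Let λ₀ ∈ (0,1), G_e invertible, R and M positive definite, D positive
semidefinite, Q_e(λ) = (((1−λ)/λ)M + D)⁻¹. Suppose Φ(λ) is symmetric positive semidefinite
for λ ∈ (0,1), entrywise differentiable at λ₀ with derivative Φ', and satisfies the DARE
Φ(λ) = G_e Q_e(λ) G_eᵀ + A_e Φ(λ) A_eᵀ − A_e Φ(λ) C_eᵀ (R + C_e Φ(λ) C_eᵀ)⁻¹ C_e Φ(λ) A_eᵀ
on (0,1). If Ā_L = A_e − L̄C_e with L̄ = A_e Φ(λ₀) C_eᵀ (R + C_e Φ(λ₀) C_eᵀ)⁻¹ is Schur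
stable, then Φ' is positive definite. -/
theorem stmt18 {n p : ℕ} (lam0 : ℝ) (hlam0 : lam0 ∈ Set.Ioo (0:ℝ) 1)
    (Ae Ge M D : Matrix (Fin n) (Fin n) ℝ) (hGe : IsUnit Ge.det)
    (Ce : Matrix (Fin p) (Fin n) ℝ) (R : Matrix (Fin p) (Fin p) ℝ) (hR : R.PosDef)
    (hM : M.PosDef) (hD : D.PosSemidef)
    (Φ : ℝ → Matrix (Fin n) (Fin n) ℝ) (Φ' : Matrix (Fin n) (Fin n) ℝ)
    (hΦpsd : ∀ lam ∈ Set.Ioo (0:ℝ) 1, (Φ lam).PosSemidef)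
    (hderiv : ∀ i j, HasDerivAt (fun l : ℝ => Φ l i j) (Φ' i j) lam0)
    (hdare : ∀ lam ∈ Set.Ioo (0:ℝ) 1,
      Φ lam = Ge * (((1 - lam) / lam) • M + D)⁻¹ * Geᵀ + Ae * Φ lam * Aeᵀ
        - Ae * Φ lam * Ceᵀ * (R + Ce * Φ lam * Ceᵀ)⁻¹ * (Ce * Φ lam * Aeᵀ))
    (hschur : SchurStable
      (Ae - Ae * Φ lam0 * Ceᵀ * (R + Ce * Φ lam0 * Ceᵀ)⁻¹ * Ce)) :
    Φ'.PosDef := by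
  obtain ⟨hl0, hl1⟩ := hlam0
  have hc : 0 < (1 - lam0) / lam0 := div_pos (by linarith) hl0
  have hN : (((1 - lam0) / lam0) • M + D).PosDef := (hM.smul hc).add_posSemidef hD
  have hS : (R + Ce * Φ lam0 * Ceᵀ).PosDef := by
    refine hR.add_posSemidef ?_
    simpa using (hΦpsd lam0 ⟨hl0, hl1⟩).mul_mul_conjTranspose_same Ce
  have hnhds : Set.Ioo (0:ℝ) 1 ∈ nhds lam0 := Ioo_mem_nhds hl0 hl1
  have hH : Φ'ᵀ = Φ' := by
    ext i j
    rw [Matrix.transpose_apply]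
    refine (hderiv j i).unique ((hderiv i j).congr_of_eventuallyEq ?_)
    filter_upwards [hnhds] with l hl
    have := (hΦpsd l hl).isHermitian.apply i j
    simpa using this
  have hPt : (Φ lam0)ᵀ = Φ lam0 := by
    simpa [Matrix.IsHermitian] using (hΦpsd lam0 ⟨hl0, hl1⟩).isHermitian
  have hTt : ((R + Ce * Φ lam0 * Ceᵀ)⁻¹)ᵀ = (R + Ce * Φ lam0 * Ceᵀ)⁻¹ := by
    simpa [Matrix.IsHermitian] using hS.inv.isHermitian
  have hQt : ((((1 - lam0) / lam0) • M + D)⁻¹)ᵀ = (((1 - lam0) / lam0) • M + D)⁻¹ := by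
    simpa [Matrix.IsHermitian] using hN.inv.isHermitian
  -- derivative of the noise weighting
  have dN : ∀ i j, HasDerivAt (fun l : ℝ => (((1 - l) / l) • M + D) i j)
      ((-(1 / lam0 ^ 2) • M) i j) lam0 := by
    intro i j
    have h1 : HasDerivAt (fun l : ℝ => (1 - l) / l) (-(1 / lam0 ^ 2)) lam0 := by
      have := ((hasDerivAt_id lam0).const_sub 1).div (hasDerivAt_id lam0) hl0.ne'
      refine HasDerivAt.congr_deriv (f' := (-1 * id lam0 - (1 - id lam0) * 1) / id lam0 ^ 2) this ?_
      simp only [id]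
      ring
    have := (h1.mul_const (M i j)).add_const (D i j)
    simpa using this
  have dQ := aux_inv _ _ lam0 dN hN.isUnit
  have dGQ := aux_mul _ _ _ _ lam0 (aux_mul _ _ _ _ lam0 (aux_const Ge lam0) dQ)
    (aux_const Geᵀ lam0)
  have dAP := aux_mul _ _ _ _ lam0 (aux_const Ae lam0) hderiv
  have dCP := aux_mul _ _ _ _ lam0 (aux_const Ce lam0) hderiv
  have dAPA := aux_mul _ _ _ _ lam0 dAP (aux_const Aeᵀ lam0)
  have dCPA := aux_mul _ _ _ _ lam0 dCP (aux_const Aeᵀ lam0)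
  have dCPC := aux_mul _ _ _ _ lam0 dCP (aux_const Ceᵀ lam0)
  have dAPC := aux_mul _ _ _ _ lam0 dAP (aux_const Ceᵀ lam0)
  have dS : ∀ i j, HasDerivAt (fun l : ℝ => (R + Ce * Φ l * Ceᵀ) i j) _ lam0 :=
    fun i j => (dCPC i j).const_add (R i j)
  have dT := aux_inv _ _ lam0 dS hS.isUnit
  have dF := aux_mul _ _ _ _ lam0 (aux_mul _ _ _ _ lam0 dAPC dT) dCPA
  have key : Φ' = Ge * ((((1 - lam0) / lam0) • M + D)⁻¹ * ((1 / lam0 ^ 2) • M) *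
        (((1 - lam0) / lam0) • M + D)⁻¹) * Geᵀ
      + (Ae - Ae * Φ lam0 * Ceᵀ * (R + Ce * Φ lam0 * Ceᵀ)⁻¹ * Ce) * Φ' *
        (Ae - Ae * Φ lam0 * Ceᵀ * (R + Ce * Φ lam0 * Ceᵀ)⁻¹ * Ce)ᵀ := by
    ext i j
    have h1 := ((dGQ i j).add (dAPA i j)).sub (dF i j)
    have h2 := (hderiv i j).unique (h1.congr_of_eventuallyEq (by
      filter_upwards [hnhds] with l hl
      conv_lhs => rw [hdare l hl]
      rfl))
    rw [h2]
    simp only [← Matrix.add_apply, ← Matrix.sub_apply]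
    refine congrFun (congrFun ?_ i) j
    simp only [Matrix.transpose_sub, Matrix.transpose_mul, Matrix.transpose_transpose, hPt, hTt]
    generalize (R + Ce * Φ lam0 * Ceᵀ)⁻¹ = T
    generalize (((1 - lam0) / lam0) • M + D)⁻¹ = Q
    simp only [Matrix.mul_sub, Matrix.sub_mul, Matrix.mul_add, Matrix.add_mul, Matrix.mul_assoc,
      Matrix.zero_mul, Matrix.mul_zero, Matrix.neg_mul, Matrix.mul_neg, neg_smul, Matrix.smul_mul,
      Matrix.mul_smul, zero_add, add_zero, neg_neg]
    abel
  refine aux_lyap _ _ _ hschur ?_ hH key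
  have hMp : ((1 / lam0 ^ 2) • M).PosDef := hM.smul (by positivity)
  have hGu : IsUnit Ge := (Matrix.isUnit_iff_isUnit_det _).2 hGe
  have h1 := (Matrix.IsUnit.posDef_star_right_conjugate_iff (x := (1 / lam0 ^ 2) • M) hN.inv.isUnit).2 hMp
  have h2 := (Matrix.IsUnit.posDef_star_right_conjugate_iff hGu).2 h1
  simpa [Matrix.star_eq_conjTranspose, hQt] using h2
end
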